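/- arXiv:2102.10328 — 3 statements merged into one kernel-verified Lean document; each statement's English description precedes it below -/
import Mathlib

section
/- For every k ≥ 3 there exists a T(k)-minimal permutation of length strictly greater than 1.07·(k+2)(k+1)/2. In particular, for every k ≥ 3 there exists a k-critical permutation of length strictly greater than 1.07·C(k+2,2). -/
/-- The subsequence of `π` indexed by `S` is increasing. -/
def IsIncOn {n : ℕ} (π : Equiv.Perm (Fin n)) (S : Set (Fin n)) : Prop :=
  ∀ i ∈ S, ∀ j ∈ S, i < j → π i < π j

/-- The subsequence of `π` indexed by `S` is decreasing. -/
def IsDecOn {n : ℕ} (π : Equiv.Perm (Fin n)) (S : Set (Fin n)) : Prop :=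
  ∀ i ∈ S, ∀ j ∈ S, i < j → π j < π i

/-- `π` is `(r,s)`-coverable: its index set can be partitioned into `r` sets
indexing increasing subsequences and `s` sets indexing decreasing subsequences. -/
def Coverable {n : ℕ} (π : Equiv.Perm (Fin n)) (r s : ℕ) : Prop :=
  ∃ c : Fin n → Fin r ⊕ Fin s,
    (∀ a : Fin r, IsIncOn π {i | c i = Sum.inl a}) ∧
    (∀ b : Fin s, IsDecOn π {i | c i = Sum.inr b})

/-- `π` is `k`-coverable: `(r,s)`-coverable for some `r + s = k`. -/
def KCoverable {n : ℕ} (π : Equiv.Perm (Fin n)) (k : ℕ) : Prop :=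
  ∃ r s, r + s = k ∧ Coverable π r s

/-- `τ` is a pattern of `π`. -/
def Pattern {m n : ℕ} (τ : Equiv.Perm (Fin m)) (π : Equiv.Perm (Fin n)) : Prop :=
  ∃ f : Fin m → Fin n, StrictMono f ∧ ∀ i j, τ i < τ j ↔ π (f i) < π (f j)

/-- `τ` is a proper pattern of `π`. -/
def ProperPattern {m n : ℕ} (τ : Equiv.Perm (Fin m)) (π : Equiv.Perm (Fin n)) : Prop :=
  m < n ∧ Pattern τ π

/-- `π` is `(r,s)`-critical. -/
def RSCritical {n : ℕ} (π : Equiv.Perm (Fin n)) (r s : ℕ) : Prop :=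
  ¬ Coverable π r s ∧
    ∀ (m : ℕ) (τ : Equiv.Perm (Fin m)), ProperPattern τ π → Coverable τ r s

/-- `π` is `k`-critical. -/
def KCritical {n : ℕ} (π : Equiv.Perm (Fin n)) (k : ℕ) : Prop :=
  ¬ KCoverable π k ∧
    ∀ (m : ℕ) (τ : Equiv.Perm (Fin m)), ProperPattern τ π → KCoverable τ k

/-- `π` is `(r,s)`-sharp: `(r,s)`-critical and `(0,s+1)`-coverable. -/
def RSSharp {n : ℕ} (π : Equiv.Perm (Fin n)) (r s : ℕ) : Prop :=
  RSCritical π r s ∧ Coverable π 0 (s + 1)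

/-- `D(π)`: the set of pairs `(r,s)` such that `π` is not `(r,s)`-coverable. -/
def DSet {n : ℕ} (π : Equiv.Perm (Fin n)) : Set (ℕ × ℕ) :=
  {p | ¬ Coverable π p.1 p.2}

/-- A downset: a finite, downward-closed subset of `ℕ²`. -/
def IsDownset (A : Set (ℕ × ℕ)) : Prop :=
  A.Finite ∧ ∀ p ∈ A, ∀ q : ℕ × ℕ, q.1 ≤ p.1 → q.2 ≤ p.2 → q ∈ A

/-- `A ⊕ B` for subsets of `ℕ²`. -/
def setOplus (A B : Set (ℕ × ℕ)) : Set (ℕ × ℕ) :=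
  {p | ∀ s₁ s₂ : ℕ, s₁ + s₂ = p.2 → (p.1, s₁) ∈ A ∨ (p.1, s₂) ∈ B}

/-- `A ⊖ B` for subsets of `ℕ²`. -/
def setOminus (A B : Set (ℕ × ℕ)) : Set (ℕ × ℕ) :=
  {p | ∀ r₁ r₂ : ℕ, r₁ + r₂ = p.1 → (r₁, p.2) ∈ A ∨ (r₂, p.2) ∈ B}

/-- `π` is `A`-coverable. -/
def ACoverable {n : ℕ} (π : Equiv.Perm (Fin n)) (A : Set (ℕ × ℕ)) : Prop :=
  ∃ p ∈ A, Coverable π p.1 p.2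

/-- `π` is `A`-critical. -/
def ACritical {n : ℕ} (π : Equiv.Perm (Fin n)) (A : Set (ℕ × ℕ)) : Prop :=
  ¬ ACoverable π A ∧
    ∀ (m : ℕ) (τ : Equiv.Perm (Fin m)), ProperPattern τ π → ACoverable τ A

/-- `π` is `A`-minimal: `A`-critical with `D(π) = A`. -/
def AMinimal {n : ℕ} (π : Equiv.Perm (Fin n)) (A : Set (ℕ × ℕ)) : Prop :=
  ACritical π A ∧ DSet π = A

/-- The triangle `T(k) = {(r,s) : r + s ≤ k}`. -/
def T (k : ℕ) : Set (ℕ × ℕ) := {p | p.1 + p.2 ≤ k}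

/-- Direct sum of permutations: `π` followed by `σ` shifted up by `n`. -/
def directSum {n m : ℕ} (π : Equiv.Perm (Fin n)) (σ : Equiv.Perm (Fin m)) :
    Equiv.Perm (Fin (n + m)) :=
  finSumFinEquiv.symm.trans ((Equiv.sumCongr π σ).trans finSumFinEquiv)

/-- Skew sum of permutations: `π` shifted up by `m`, followed by `σ`. -/
def skewSum {n m : ℕ} (π : Equiv.Perm (Fin n)) (σ : Equiv.Perm (Fin m)) :
    Equiv.Perm (Fin (n + m)) :=
  finSumFinEquiv.symm.trans (((Equiv.sumCongr π σ).trans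
    (Equiv.sumComm (Fin n) (Fin m))).trans
    (finSumFinEquiv.trans (finCongr (Nat.add_comm m n))))

/-- Tensor product of permutations: `n` copies of `σ`, ordered like `π`. -/
def tensorProd {n m : ℕ} (π : Equiv.Perm (Fin n)) (σ : Equiv.Perm (Fin m)) :
    Equiv.Perm (Fin (n * m)) :=
  finProdFinEquiv.symm.trans ((Equiv.prodCongr π σ).trans finProdFinEquiv)

section Cocoloring

open SimpleGraph

variable {V W : Type*} {G : SimpleGraph V} {H : SimpleGraph W}

/-- A map to `α ⊕ β` is a cocoloring of `G` if the fibres over `α` are independent sets and the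
fibres over `β` are cliques. -/
def IsCocoloring {α β : Type*} (G : SimpleGraph V) (c : V → α ⊕ β) : Prop :=
  ∀ x y, x ≠ y → c x = c y → (G.Adj x y ↔ (c x).isRight = true)

/-- The vertices of `G` can be partitioned into `r` independent sets and `s` cliques. -/
def Cocolorable (G : SimpleGraph V) (r s : ℕ) : Prop :=
  ∃ c : V → Fin r ⊕ Fin s, IsCocoloring G c

theorem IsCocoloring.cocolorable {α β : Type*} [Fintype α] [Fintype β] {c : V → α ⊕ β}
    (hc : IsCocoloring G c) {r s : ℕ} (hr : Fintype.card α ≤ r) (hs : Fintype.card β ≤ s) :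
    Cocolorable G r s := by
  obtain ⟨f⟩ : Nonempty (α ↪ Fin r) := Function.Embedding.nonempty_of_card_le (by simpa using hr)
  obtain ⟨g⟩ : Nonempty (β ↪ Fin s) := Function.Embedding.nonempty_of_card_le (by simpa using hs)
  refine ⟨fun x => Sum.map f g (c x), fun x y hxy h => ?_⟩
  rw [hc x y hxy (Sum.map_injective.2 ⟨f.injective, g.injective⟩ h), Sum.isRight_map]

theorem Cocolorable.mono {r s r' s' : ℕ} (h : Cocolorable G r s) (hr : r ≤ r') (hs : s ≤ s') :
    Cocolorable G r' s' := by
  obtain ⟨c, hc⟩ := h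
  exact hc.cocolorable (by simpa using hr) (by simpa using hs)

theorem Cocolorable.comap {r s : ℕ} (h : Cocolorable H r s) {f : V → W}
    (hf : Function.Injective f) (hadj : ∀ x y, H.Adj (f x) (f y) ↔ G.Adj x y) :
    Cocolorable G r s := by
  obtain ⟨c, hc⟩ := h
  exact ⟨c ∘ f, fun x y hxy h => by rw [← hadj]; exact hc _ _ (hf.ne hxy) h⟩

theorem Cocolorable.compl {r s : ℕ} (h : Cocolorable G r s) : Cocolorable Gᶜ s r := by
  obtain ⟨c, hc⟩ := h
  refine ⟨Sum.swap ∘ c, fun x y hxy h => ?_⟩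
  have := hc x y hxy (Sum.swap_leftInverse.injective h)
  rw [SimpleGraph.compl_adj, this]
  cases hx : c x <;> simp [hx, hxy]

theorem Cocolorable.sum {r s t : ℕ} (hG : Cocolorable G r s) (hH : Cocolorable H r t) :
    Cocolorable (G ⊕g H) r (s + t) := by
  obtain ⟨c, hc⟩ := hG
  obtain ⟨d, hd⟩ := hH
  have key : IsCocoloring (G ⊕g H)
      (Sum.elim (Sum.map id Sum.inl ∘ c) (Sum.map id Sum.inr ∘ d) :
        V ⊕ W → Fin r ⊕ (Fin s ⊕ Fin t)) := by
    rintro (x | x) (y | y) hxy h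
    · have := hc x y (by simpa using hxy)
        (Sum.map_injective.2 ⟨Function.injective_id, Sum.inl_injective⟩ h)
      simpa using this
    · cases hx : c x <;> cases hy : d y <;> simp_all
    · cases hx : d x <;> cases hy : c y <;> simp_all
    · have := hd x y (by simpa using hxy)
        (Sum.map_injective.2 ⟨Function.injective_id, Sum.inr_injective⟩ h)
      simpa using this
  exact key.cocolorable (by simp) (by simp)

theorem IsCocoloring.of_lift {α β γ : Type*} {c : V → α ⊕ β} (hc : IsCocoloring G c)
    {g : γ → β} {d : V → α ⊕ γ} (hd : ∀ x, Sum.map id g (d x) = c x) : IsCocoloring G d := by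
  intro x y hxy h
  rw [hc x y hxy (by rw [← hd, ← hd, h]), ← hd, Sum.isRight_map]

theorem Cocolorable.exists_of_sum {r u : ℕ} (h : Cocolorable (G ⊕g H) r u) :
    ∃ s t, s + t = u ∧ Cocolorable G r s ∧ Cocolorable H r t := by
  classical
  obtain ⟨c, hc⟩ := h
  let P : Fin u → Prop := fun b => ∃ x, c (.inl x) = .inr b
  have hl : IsCocoloring G (fun x => c (.inl x)) := fun x y hxy h => by
    simpa using hc (.inl x) (.inl y) (by simpa using hxy) h
  have hr : IsCocoloring H (fun x => c (.inr x)) := fun x y hxy h => by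
    simpa using hc (.inr x) (.inr y) (by simpa using hxy) h
  have hl' : ∀ x, ∃ z : Fin r ⊕ {b // P b}, Sum.map id Subtype.val z = c (.inl x) := fun x => by
    cases hx : c (.inl x) with
    | inl a => exact ⟨.inl a, rfl⟩
    | inr b => exact ⟨.inr ⟨b, x, hx⟩, rfl⟩
  have hr' : ∀ x, ∃ z : Fin r ⊕ {b // ¬ P b}, Sum.map id Subtype.val z = c (.inr x) := fun x => by
    cases hx : c (.inr x) with
    | inl a => exact ⟨.inl a, rfl⟩
    | inr b =>
      refine ⟨.inr ⟨b, ?_⟩, rfl⟩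
      rintro ⟨y, hy⟩
      have := hc (.inl y) (.inr x) (by simp) (by rw [hx, hy])
      simp [hy] at this
  choose d hd using hl'
  choose e he using hr'
  refine ⟨Fintype.card {b // P b}, Fintype.card {b // ¬ P b}, ?_,
    (hl.of_lift hd).cocolorable (by simp) le_rfl, (hr.of_lift he).cocolorable (by simp) le_rfl⟩
  have h1 := Fintype.card_subtype_compl P
  have h2 := Fintype.card_subtype_le P
  rw [Fintype.card_fin] at h1 h2
  omega

/-- The set of pairs with column heights `a`. -/
def columns (a : ℕ → ℕ) : Set (ℕ × ℕ) := {p | p.2 < a p.1}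

/-- The set of pairs with row lengths `a`. -/
def rows (a : ℕ → ℕ) : Set (ℕ × ℕ) := {p | p.1 < a p.2}

/-- `A` is exactly the set of pairs for which `G` is not cocolorable, and deleting any vertex
makes `G` cocolorable for some pair in `A`. -/
def CocoloringMinimal (G : SimpleGraph V) (A : Set (ℕ × ℕ)) : Prop :=
  (∀ r s, Cocolorable G r s ↔ (r, s) ∉ A) ∧
    ∀ x, ∃ p ∈ A, Cocolorable (G.induce {x}ᶜ) p.1 p.2

theorem CocoloringMinimal.iso {A : Set (ℕ × ℕ)} (h : CocoloringMinimal G A) (e : G ≃g H) :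
    CocoloringMinimal H A := by
  refine ⟨fun r s => ?_, fun x => ?_⟩
  · rw [← h.1]
    exact ⟨fun hH => hH.comap e.injective fun _ _ => e.map_adj_iff,
      fun hG => hG.comap e.symm.injective fun _ _ => e.symm.map_adj_iff⟩
  · obtain ⟨p, hp, hc⟩ := h.2 (e.symm x)
    refine ⟨p, hp, hc.comap (f := fun y => ⟨e.symm y.1, fun hy => y.2 (e.symm.injective hy)⟩)
      (fun y z hyz => Subtype.ext (e.symm.injective (congrArg Subtype.val hyz)))
      fun y z => e.symm.map_adj_iff⟩

theorem CocoloringMinimal.compl {A : Set (ℕ × ℕ)} (h : CocoloringMinimal G A) :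
    CocoloringMinimal Gᶜ (Prod.swap ⁻¹' A) := by
  refine ⟨fun r s => ?_, fun x => ?_⟩
  · change _ ↔ (s, r) ∉ A
    rw [← h.1]
    exact ⟨fun hG => by simpa using hG.compl, fun hG => hG.compl⟩
  · obtain ⟨p, hp, hc⟩ := h.2 x
    refine ⟨p.swap, by simpa using hp, hc.compl.comap Function.injective_id fun y z => ?_⟩
    simp [SimpleGraph.compl_adj, Subtype.ext_iff]

theorem CocoloringMinimal.sum {a b : ℕ → ℕ} (hG : CocoloringMinimal G (columns a))
    (hH : CocoloringMinimal H (columns b)) :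
    CocoloringMinimal (G ⊕g H) (columns fun r => a r + b r) := by
  have hGa : ∀ r, Cocolorable G r (a r) := fun r => (hG.1 r (a r)).2 (by simp [columns])
  have hHb : ∀ r, Cocolorable H r (b r) := fun r => (hH.1 r (b r)).2 (by simp [columns])
  refine ⟨fun r u => ⟨fun h => ?_, fun h => ?_⟩, ?_⟩
  · obtain ⟨s, t, rfl, hs, ht⟩ := h.exists_of_sum
    have h1 := (hG.1 r s).1 hs
    have h2 := (hH.1 r t).1 ht
    simp only [columns, Set.mem_ofPred_eq] at h1 h2 ⊢
    omega
  · exact ((hGa r).sum (hHb r)).mono le_rfl (by simpa [columns] using h)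
  · rintro (x | x)
    · obtain ⟨⟨r, s⟩, hp, hc⟩ := hG.2 x
      refine ⟨(r, s + b r), by simpa [columns] using hp, (hc.sum (hHb r)).comap
        (f := fun y => match y with
          | ⟨.inl y, hy⟩ => .inl ⟨y, fun h => hy (congrArg Sum.inl h)⟩
          | ⟨.inr y, _⟩ => .inr y) ?_ ?_⟩
      · rintro ⟨y | y, hy⟩ ⟨z | z, hz⟩ h <;> simp_all
      · rintro ⟨y | y, hy⟩ ⟨z | z, hz⟩ <;> simp
    · obtain ⟨⟨r, s⟩, hp, hc⟩ := hH.2 x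
      refine ⟨(r, a r + s), by simpa [columns] using hp, ((hGa r).sum hc).comap
        (f := fun y => match y with
          | ⟨.inr y, hy⟩ => .inr ⟨y, fun h => hy (congrArg Sum.inr h)⟩
          | ⟨.inl y, _⟩ => .inl y) ?_ ?_⟩
      · rintro ⟨y | y, hy⟩ ⟨z | z, hz⟩ h <;> simp_all
      · rintro ⟨y | y, hy⟩ ⟨z | z, hz⟩ <;> simp

end Cocoloring

section Inversions

variable {n m : ℕ}

/-- The inversion graph of a permutation. -/
def inversionGraph (π : Equiv.Perm (Fin n)) : SimpleGraph (Fin n) where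
  Adj i j := (i < j ∧ π j < π i) ∨ (j < i ∧ π i < π j)
  symm := ⟨fun _ _ h => h.symm⟩
  loopless := ⟨fun _ h => by simp at h⟩

theorem inversionGraph_adj (π : Equiv.Perm (Fin n)) (i j : Fin n) :
    (inversionGraph π).Adj i j ↔ (i < j ∧ π j < π i) ∨ (j < i ∧ π i < π j) := Iff.rfl

theorem inversionGraph_adj_of_lt (π : Equiv.Perm (Fin n)) {i j : Fin n} (h : i < j) :
    (inversionGraph π).Adj i j ↔ π j < π i := by
  simp [inversionGraph_adj, h, h.asymm]

theorem coverable_iff_cocolorable (π : Equiv.Perm (Fin n)) (r s : ℕ) :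
    Coverable π r s ↔ Cocolorable (inversionGraph π) r s := by
  refine exists_congr fun c => ⟨fun h => ?_, fun h => ⟨fun a i hi j hj hij => ?_,
    fun b i hi j hj hij => ?_⟩⟩
  · have key : ∀ i j, i < j → c i = c j →
        ((inversionGraph π).Adj i j ↔ (c i).isRight = true) := by
      intro i j hij hc
      rw [inversionGraph_adj_of_lt π hij]
      cases hi : c i with
      | inl a => simpa using (h.1 a i hi j (hc.symm.trans hi) hij).le
      | inr b => simpa using h.2 b i hi j (hc.symm.trans hi) hij
    intro i j hij hc
    rcases lt_or_gt_of_ne hij with hij | hij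
    · exact key i j hij hc
    · rw [SimpleGraph.adj_comm, hc]
      exact key j i hij hc.symm
  · have := h i j hij.ne (hi.trans hj.symm)
    rw [inversionGraph_adj_of_lt π hij, show c i = _ from hi] at this
    simp only [Sum.isRight_inl, Bool.false_eq_true, iff_false, not_lt] at this
    exact this.lt_of_ne (π.injective.ne hij.ne)
  · have := h i j hij.ne (hi.trans hj.symm)
    rw [inversionGraph_adj_of_lt π hij, show c i = _ from hi] at this
    simpa using this

theorem inversionGraph_reverse (π : Equiv.Perm (Fin n)) :
    inversionGraph (π.trans Fin.revPerm) = (inversionGraph π)ᶜ := by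
  ext i j
  have h : π i = π j ↔ i = j := π.injective.eq_iff
  simp only [inversionGraph_adj, SimpleGraph.compl_adj, Equiv.trans_apply, Fin.revPerm_apply,
    Fin.rev_lt_rev]
  grind

/-- The inversion graph of a direct sum is the disjoint union of the inversion graphs. -/
def inversionGraphDirectSumIso (π : Equiv.Perm (Fin n)) (σ : Equiv.Perm (Fin m)) :
    (inversionGraph π ⊕g inversionGraph σ) ≃g inversionGraph (directSum π σ) where
  toEquiv := finSumFinEquiv
  map_rel_iff' := by
    rintro (i | i) (j | j) <;>
      simp [inversionGraph_adj, directSum, Fin.lt_def, -Fin.val_fin_lt] <;> omega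

theorem CocoloringMinimal.aCoverable_of_properPattern {π : Equiv.Perm (Fin n)}
    {A : Set (ℕ × ℕ)} (h : CocoloringMinimal (inversionGraph π) A) {τ : Equiv.Perm (Fin m)}
    (hτ : ProperPattern τ π) : ACoverable τ A := by
  obtain ⟨hmn, f, hf, hfτ⟩ := hτ
  obtain ⟨x, hx⟩ : ∃ x, ∀ i, f i ≠ x := by
    by_contra! hsurj
    have := Fintype.card_le_of_surjective f hsurj
    simp only [Fintype.card_fin] at this
    omega
  obtain ⟨p, hp, hc⟩ := h.2 x
  refine ⟨p, hp, (coverable_iff_cocolorable _ _ _).2 (hc.comap (f := fun i => ⟨f i, hx i⟩)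
    (fun i j hij => hf.injective (congrArg Subtype.val hij)) fun i j => ?_)⟩
  simp [inversionGraph_adj, hf.lt_iff_lt, hfτ]

theorem CocoloringMinimal.aMinimal {π : Equiv.Perm (Fin n)} {A : Set (ℕ × ℕ)}
    (h : CocoloringMinimal (inversionGraph π) A) : AMinimal π A := by
  refine ⟨⟨?_, fun m τ hτ => h.aCoverable_of_properPattern hτ⟩, ?_⟩
  · rintro ⟨p, hp, hc⟩
    exact (h.1 p.1 p.2).1 ((coverable_iff_cocolorable _ _ _).1 hc) hp
  · ext p
    simp [DSet, coverable_iff_cocolorable, h.1]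

theorem AMinimal.kCritical {π : Equiv.Perm (Fin n)} {k : ℕ} (h : AMinimal π (T k)) :
    KCritical π k := by
  refine ⟨?_, fun m τ hτ => ?_⟩
  · rintro ⟨r, s, hrs, hc⟩
    exact h.1.1 ⟨(r, s), hrs.le, hc⟩
  · obtain ⟨⟨r, s⟩, hrs, hc⟩ := h.1.2 m τ hτ
    have hrs : r + s ≤ k := hrs
    refine ⟨r, k - r, by omega, ?_⟩
    rw [coverable_iff_cocolorable] at hc ⊢
    exact hc.mono le_rfl (by simp only; omega)

end Inversions

section Realizable

/-- Some permutation of length `L` has a cocoloring-minimal inversion graph for `A`. -/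
def Realizable (L : ℕ) (A : Set (ℕ × ℕ)) : Prop :=
  ∃ π : Equiv.Perm (Fin L), CocoloringMinimal (inversionGraph π) A

theorem Realizable.swap {L : ℕ} {A : Set (ℕ × ℕ)} (h : Realizable L A) :
    Realizable L (Prod.swap ⁻¹' A) := by
  obtain ⟨π, hπ⟩ := h
  exact ⟨π.trans Fin.revPerm, by rw [inversionGraph_reverse]; exact hπ.compl⟩

theorem Realizable.add_columns {L M : ℕ} {a b : ℕ → ℕ} (hL : Realizable L (columns a))
    (hM : Realizable M (columns b)) : Realizable (L + M) (columns fun r => a r + b r) := by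
  obtain ⟨π, hπ⟩ := hL
  obtain ⟨σ, hσ⟩ := hM
  exact ⟨directSum π σ, (hπ.sum hσ).iso (inversionGraphDirectSumIso π σ)⟩

theorem Realizable.add_rows {L M : ℕ} {a b : ℕ → ℕ} (hL : Realizable L (rows a))
    (hM : Realizable M (rows b)) : Realizable (L + M) (rows fun s => a s + b s) :=
  (Realizable.add_columns (a := a) (b := b) hL.swap hM.swap).swap

/-- The Young diagram with two rows, of lengths `a` and `b`. -/
def twoRows (a b : ℕ) : Set (ℕ × ℕ) :=
  rows fun s => if s = 0 then a else if s = 1 then b else 0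

/-- The triangle with rows `n, n - 1, …, 1`. -/
def triangle (n : ℕ) : Set (ℕ × ℕ) := columns fun r => n - r

theorem Realizable.add_twoRows {L M a b a' b' : ℕ} (hL : Realizable L (twoRows a b))
    (hM : Realizable M (twoRows a' b')) : Realizable (L + M) (twoRows (a + a') (b + b')) := by
  convert hL.add_rows hM using 1
  refine congrArg rows (funext fun s => ?_)
  split_ifs <;> rfl

theorem twoRows_eq {a b : ℕ} (h : b ≤ a) :
    twoRows a b = columns fun r => (if r < b then 1 else 0) + (if r < a then 1 else 0) := by
  ext ⟨r, s⟩
  simp only [twoRows, rows, columns, Set.mem_ofPred_eq]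
  split_ifs <;> omega

theorem realizable_empty : Realizable 0 ∅ :=
  ⟨1, fun r s => ⟨fun _ => by simp, fun _ => ⟨Fin.elim0, fun x => x.elim0⟩⟩, fun x => x.elim0⟩

theorem realizable_triangle_one : Realizable 1 (triangle 1) := by
  refine ⟨1, fun r s => ?_, fun x =>
    ⟨(0, 0), by simp [triangle, columns], fun y => ?_, fun y => ?_⟩⟩
  · simp only [triangle, columns, Set.mem_ofPred_eq]
    constructor
    · rintro ⟨c, -⟩
      cases hc : c 0 with
      | inl a => have := a.2; omega
      | inr b => have := b.2; omega
    · intro h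
      obtain h | h : 0 < r ∨ 0 < s := by omega
      · exact ⟨fun _ => .inl ⟨0, h⟩, fun x y hxy => absurd (Subsingleton.elim x y) hxy⟩
      · exact ⟨fun _ => .inr ⟨0, h⟩, fun x y hxy => absurd (Subsingleton.elim x y) hxy⟩
  · exact absurd (Subsingleton.elim y.1 x) y.2
  · exact absurd (Subsingleton.elim y.1 x) y.2

theorem realizable_twoRows_one_one : Realizable 2 (twoRows 1 1) := by
  convert realizable_triangle_one.add_columns realizable_triangle_one using 1
  ext ⟨r, s⟩
  simp only [twoRows, rows, columns, Set.mem_ofPred_eq]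
  split_ifs <;> omega

theorem realizable_twoRows_one_zero : Realizable 1 (twoRows 1 0) := by
  convert realizable_triangle_one using 1
  ext ⟨r, s⟩
  simp only [twoRows, rows, triangle, columns, Set.mem_ofPred_eq]
  split_ifs <;> omega

theorem realizable_triangle_two : Realizable 3 (triangle 2) := by
  convert realizable_twoRows_one_one.add_twoRows realizable_twoRows_one_zero using 1
  ext ⟨r, s⟩
  simp only [twoRows, rows, triangle, columns, Set.mem_ofPred_eq]
  split_ifs <;> omega

theorem Realizable.nsmul_twoRows {L a b : ℕ} (h : Realizable L (twoRows a b)) (e : ℕ) :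
    Realizable (L * e) (twoRows (a * e) (b * e)) := by
  induction e with
  | zero =>
    have : twoRows (a * 0) (b * 0) = ∅ := by
      ext ⟨r, s⟩
      simp [twoRows, rows]
    rw [this]
    exact realizable_empty
  | succ e ih => exact ih.add_twoRows h

end Realizable

section Gadgets

/-- `c` is a cocoloring of `G` away from the vertex `x`. -/
def IsCocoloringOff {V : Type*} {r s : ℕ} (G : SimpleGraph V) (x : V) (c : V → Fin r ⊕ Fin s) :
    Prop :=
  ∀ y z, y ≠ x → z ≠ x → y ≠ z → c y = c z → (G.Adj y z ↔ (c y).isRight = true)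

theorem IsCocoloringOff.cocolorable {V : Type*} {r s : ℕ} {G : SimpleGraph V} {x : V}
    {c : V → Fin r ⊕ Fin s} (h : IsCocoloringOff G x c) : Cocolorable (G.induce {x}ᶜ) r s :=
  ⟨fun y => c y.1, fun y z hyz hc => h y z y.2 z.2 (fun h => hyz (Subtype.ext h)) hc⟩

instance {n : ℕ} (π : Equiv.Perm (Fin n)) : DecidableRel (inversionGraph π).Adj :=
  fun i j => decidable_of_iff _ (inversionGraph_adj π i j).symm

variable {V : Type*} [DecidableEq V] (G : SimpleGraph V) [DecidableRel G.Adj]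

instance {r s : ℕ} [Fintype V] (c : V → Fin r ⊕ Fin s) : Decidable (IsCocoloring G c) :=
  inferInstanceAs (Decidable (∀ x y, x ≠ y → c x = c y → (G.Adj x y ↔ (c x).isRight = true)))

instance {r s : ℕ} [Fintype V] (x : V) (c : V → Fin r ⊕ Fin s) :
    Decidable (IsCocoloringOff G x c) :=
  inferInstanceAs (Decidable (∀ y z, y ≠ x → z ≠ x → y ≠ z → c y = c z →
    (G.Adj y z ↔ (c y).isRight = true)))

/-- Backtracking search: the partial cocoloring recorded in the second list cannot be extended to
the vertices in the first list. -/
def noExtension {r s : ℕ} : List V → List (V × (Fin r ⊕ Fin s)) → Bool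
  | [], _ => false
  | x :: l, d => decide (∀ v : Fin r ⊕ Fin s,
      (∃ q ∈ d, x ≠ q.1 ∧ v = q.2 ∧ ¬ (G.Adj x q.1 ↔ v.isRight = true)) ∨
        noExtension l ((x, v) :: d) = true)

variable {G}

theorem IsCocoloring.noExtension_eq_false {r s : ℕ} {c : V → Fin r ⊕ Fin s}
    (hc : IsCocoloring G c) (l : List V) (d : List (V × (Fin r ⊕ Fin s)))
    (hd : ∀ q ∈ d, c q.1 = q.2) : noExtension G l d = false := by
  induction l generalizing d with
  | nil => rfl
  | cons x l ih =>
    rw [noExtension, decide_eq_false_iff_not]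
    intro h
    obtain ⟨q, hq, hne, hv, hadj⟩ | h := h (c x)
    · exact hadj (hc x q.1 hne (hv.trans (hd q hq).symm))
    · rw [ih ((x, c x) :: d) (by simpa using hd)] at h
      exact Bool.false_ne_true h

theorem not_cocolorable_of_noExtension {r s : ℕ} (l : List V)
    (h : noExtension (r := r) (s := s) G l [] = true) : ¬ Cocolorable G r s := by
  rintro ⟨c, hc⟩
  rw [hc.noExtension_eq_false l [] (by simp)] at h
  exact Bool.false_ne_true h

/-- The permutation `7 4 2 8 6 1 5 3`, of length `8` but realizing only `4 + 3` pairs. -/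
def permFourThree : Equiv.Perm (Fin 8) where
  toFun := ![6, 3, 1, 7, 5, 0, 4, 2]
  invFun := ![5, 2, 7, 1, 6, 4, 0, 3]
  left_inv := by decide
  right_inv := by decide

/-- The permutation `7 6 4 1 8 5 3 2`, of length `8` but realizing only `5 + 2` pairs. -/
def permFiveTwo : Equiv.Perm (Fin 8) where
  toFun := ![6, 5, 3, 0, 7, 4, 2, 1]
  invFun := ![3, 7, 6, 2, 5, 1, 0, 4]
  left_inv := by decide
  right_inv := by decide

theorem realizable_twoRows_four_three : Realizable 8 (twoRows 4 3) := by
  have h40 : Cocolorable (inversionGraph permFourThree) 4 0 :=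
    ⟨.inl ∘ ![0, 1, 2, 0, 1, 3, 2, 3], by decide⟩
  have h31 : Cocolorable (inversionGraph permFourThree) 3 1 :=
    ⟨![.inl 0, .inl 1, .inl 2, .inl 0, .inr 0, .inr 0, .inl 1, .inl 2], by decide⟩
  have h02 : Cocolorable (inversionGraph permFourThree) 0 2 :=
    ⟨.inr ∘ ![0, 0, 0, 1, 1, 0, 1, 1], by decide⟩
  have h30 : ¬ Cocolorable (inversionGraph permFourThree) 3 0 :=
    not_cocolorable_of_noExtension [0, 4, 6, 7] (by decide)
  have h21 : ¬ Cocolorable (inversionGraph permFourThree) 2 1 :=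
    not_cocolorable_of_noExtension (List.finRange 8) (by decide)
  refine ⟨permFourThree, fun r s => ?_, fun x => ⟨(2, 1), by simp [twoRows, rows], ?_⟩⟩
  · simp only [twoRows, rows, Set.mem_ofPred_eq, not_lt]
    constructor
    · intro h
      split_ifs with h0 h1
      · by_contra! hr
        exact h30 (h.mono (by omega) (by omega))
      · by_contra! hr
        exact h21 (h.mono (by omega) (by omega))
      · exact Nat.zero_le r
    · intro h
      split_ifs at h with h0 h1
      · exact h40.mono h (by omega)
      · exact h31.mono h (by omega)
      · exact h02.mono h (by omega)
  · have key : ∀ x : Fin 8, ∃ c ∈ ([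
          ![.inl 0, .inl 0, .inl 1, .inr 0, .inr 0, .inr 0, .inl 0, .inl 1],
          ![.inr 0, .inl 0, .inl 0, .inl 0, .inr 0, .inl 1, .inl 1, .inr 0],
          ![.inr 0, .inl 0, .inl 1, .inl 0, .inr 0, .inr 0, .inl 0, .inl 1],
          ![.inr 0, .inr 0, .inl 0, .inl 0, .inl 0, .inl 1, .inl 1, .inr 0],
          ![.inr 0, .inl 0, .inl 1, .inl 0, .inl 1, .inl 0, .inr 0, .inr 0],
          ![.inr 0, .inl 0, .inl 1, .inl 0, .inr 0, .inr 0, .inl 1, .inl 0]] :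
            List (Fin 8 → Fin 2 ⊕ Fin 1)),
          IsCocoloringOff (inversionGraph permFourThree) x c := by
      decide
    obtain ⟨c, -, hc⟩ := key x
    exact hc.cocolorable

theorem realizable_twoRows_five_two : Realizable 8 (twoRows 5 2) := by
  have h50 : Cocolorable (inversionGraph permFiveTwo) 5 0 :=
    ⟨.inl ∘ ![0, 1, 2, 3, 0, 2, 3, 4], by decide⟩
  have h21 : Cocolorable (inversionGraph permFiveTwo) 2 1 :=
    ⟨![.inl 0, .inr 0, .inr 0, .inl 1, .inl 0, .inl 1, .inr 0, .inr 0], by decide⟩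
  have h02 : Cocolorable (inversionGraph permFiveTwo) 0 2 :=
    ⟨.inr ∘ ![0, 0, 0, 0, 1, 1, 1, 1], by decide⟩
  have h40 : ¬ Cocolorable (inversionGraph permFiveTwo) 4 0 :=
    not_cocolorable_of_noExtension [0, 1, 2, 6, 7] (by decide)
  have h11 : ¬ Cocolorable (inversionGraph permFiveTwo) 1 1 :=
    not_cocolorable_of_noExtension (List.finRange 8) (by decide)
  refine ⟨permFiveTwo, fun r s => ?_, fun x => ?_⟩
  · simp only [twoRows, rows, Set.mem_ofPred_eq, not_lt]
    constructor
    · intro h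
      split_ifs with h0 h1
      · by_contra! hr
        exact h40 (h.mono (by omega) (by omega))
      · by_contra! hr
        exact h11 (h.mono (by omega) (by omega))
      · exact Nat.zero_le r
    · intro h
      split_ifs at h with h0 h1
      · exact h50.mono h (by omega)
      · exact h21.mono h (by omega)
      · exact h02.mono h (by omega)
  · have key : ∀ x : Fin 8,
        (∃ c ∈ ([![.inr 0, .inr 0, .inl 0, .inl 0, .inl 0, .inr 0, .inr 0, .inr 0],
          ![.inr 0, .inr 0, .inr 0, .inl 0, .inl 0, .inl 0, .inr 0, .inr 0]] :
            List (Fin 8 → Fin 1 ⊕ Fin 1)),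
          IsCocoloringOff (inversionGraph permFiveTwo) x c) ∨
        (∃ c ∈ ([![.inl 0, .inl 0, .inl 1, .inl 2, .inl 0, .inl 1, .inl 2, .inl 3],
          ![.inl 0, .inl 1, .inl 2, .inl 3, .inl 0, .inl 2, .inl 0, .inl 3],
          ![.inl 0, .inl 1, .inl 2, .inl 3, .inl 0, .inl 2, .inl 3, .inl 0]] :
            List (Fin 8 → Fin 4 ⊕ Fin 0)),
          IsCocoloringOff (inversionGraph permFiveTwo) x c) := by
      decide
    obtain ⟨c, -, hc⟩ | ⟨c, -, hc⟩ := key x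
    · exact ⟨(1, 1), by simp [twoRows, rows], hc.cocolorable⟩
    · exact ⟨(4, 0), by simp [twoRows, rows], hc.cocolorable⟩

end Gadgets

section Triangles

theorem realizable_twoRows_add {d i : ℕ} (h : 3 * d ≤ i) :
    Realizable (2 * i + 2 * d) (twoRows (i + d) i) := by
  obtain ⟨e, rfl⟩ := Nat.exists_eq_add_of_le h
  convert (realizable_twoRows_four_three.nsmul_twoRows d).add_twoRows
    (realizable_twoRows_one_one.nsmul_twoRows e) using 1
  · ring
  · congr 1 <;> ring

theorem sum_indicator_lt (r m t : ℕ) :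
    ∑ j ∈ Finset.range t, (if r < m + 1 + j then 1 else 0) = (m + t - r) - (m - r) := by
  induction t with
  | zero => simp
  | succ t ih =>
    rw [Finset.sum_range_succ, ih]
    split_ifs <;> omega

/-- Rows `m + 1, …, m + 2 * d` are added to the triangle in pairs whose lengths differ by `d`. -/
theorem Realizable.triangle_add {L m d : ℕ} (hL : Realizable L (triangle m))
    (hd : 3 * d ≤ m + 1) :
    Realizable (L + d * (2 * m + 3 * d + 1)) (triangle (m + 2 * d)) := by
  have key : ∀ t, Realizable (L + ∑ j ∈ Finset.range t, (2 * (m + 1 + j) + 2 * d))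
      (columns fun r => (m - r) + ∑ j ∈ Finset.range t,
        ((if r < m + 1 + j then 1 else 0) + (if r < m + 1 + j + d then 1 else 0))) := by
    intro t
    induction t with
    | zero => simpa [triangle] using hL
    | succ t ih =>
      have hrow := realizable_twoRows_add (d := d) (i := m + 1 + t) (by omega)
      rw [twoRows_eq (by omega)] at hrow
      simpa only [Finset.sum_range_succ, add_assoc] using ih.add_columns hrow
  convert key d using 1
  · congr 1
    have : ∀ t, ∑ j ∈ Finset.range t, (2 * (m + 1 + j) + 2 * d) = t * (2 * m + 2 * d + t + 1) := by
      intro t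
      induction t with
      | zero => simp
      | succ t ih => rw [Finset.sum_range_succ, ih]; ring
    rw [this]
    ring
  · ext ⟨r, s⟩
    have h1 := sum_indicator_lt r m d
    have h2 := sum_indicator_lt r (m + d) d
    have h3 : ∀ j, m + 1 + j + d = m + d + 1 + j := fun j => by omega
    simp only [triangle, columns, Set.mem_ofPred_eq, Finset.sum_add_distrib, h3, h1, h2]
    omega

theorem realizable_triangle_five : Realizable 17 (triangle 5) := by
  have h1 := realizable_twoRows_four_three
  have h2 := realizable_twoRows_five_two
  rw [twoRows_eq (by norm_num)] at h1 h2
  convert (realizable_triangle_one.add_columns h1).add_columns h2 using 1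
  ext ⟨r, s⟩
  simp only [triangle, columns, Set.mem_ofPred_eq]
  split_ifs <;> omega

theorem exists_realizable_triangle (n : ℕ) (hn : 4 ≤ n) :
    ∃ L, 107 * (n * (n + 1)) < 200 * L ∧ Realizable L (triangle n) := by
  induction n using Nat.strong_induction_on with
  | _ n ih =>
    obtain rfl | rfl | h6 : n = 4 ∨ n = 5 ∨ 6 ≤ n := by omega
    · exact ⟨11, by norm_num, realizable_triangle_two.triangle_add (d := 1) (by norm_num)⟩
    · exact ⟨17, by norm_num, realizable_triangle_five⟩
    · obtain ⟨d, hd⟩ : ∃ d, d = (n + 1) / 5 := ⟨_, rfl⟩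
      obtain ⟨m, rfl⟩ : ∃ m, n = m + 2 * d := ⟨n - 2 * d, by omega⟩
      obtain ⟨L, hL, hR⟩ := ih m (by omega) (by omega)
      refine ⟨_, ?_, hR.triangle_add (by omega)⟩
      obtain h8 | h8 : m + 2 * d = 8 ∨ m + 2 * d ≠ 8 := by omega
      · obtain rfl : d = 1 := by omega
        obtain rfl : m = 6 := by omega
        omega
      · have h : 7 * (2 * m + 2 * d + 1) ≤ 100 * d := by omega
        nlinarith [Nat.mul_le_mul_left d h]

end Triangles

/-- Corollary 7: for every `k ≥ 3` there is a `T(k)`-minimal permutation of length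
`> 1.07·(k+2)(k+1)/2`; in particular a `k`-critical permutation of length
`> 1.07·(k+2 choose 2)`. -/
theorem long_Tminimal (k : ℕ) (hk : 3 ≤ k) :
    (∃ (n : ℕ) (π : Equiv.Perm (Fin n)), AMinimal π (T k) ∧
      1.07 * (((k : ℝ) + 2) * ((k : ℝ) + 1) / 2) < (n : ℝ)) ∧
    (∃ (n : ℕ) (π : Equiv.Perm (Fin n)), KCritical π k ∧
      1.07 * ((Nat.choose (k + 2) 2 : ℕ) : ℝ) < (n : ℝ)) := by
  obtain ⟨L, hL, π, hπ⟩ := exists_realizable_triangle (k + 1) (by omega)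
  have hT : triangle (k + 1) = T k := by
    ext ⟨r, s⟩
    simp only [triangle, columns, T, Set.mem_ofPred_eq]
    omega
  rw [hT] at hπ
  have hmin := hπ.aMinimal
  have hlen : 1.07 * (((k : ℝ) + 2) * ((k : ℝ) + 1) / 2) < (L : ℝ) := by
    have h : (107 * ((k + 1) * (k + 1 + 1)) : ℝ) < 200 * L := by exact_mod_cast hL
    linarith
  refine ⟨⟨L, π, hmin, hlen⟩, L, π, hmin.kCritical, ?_⟩
  rw [Nat.cast_choose_two]
  push_cast
  linarith
end

section
/- Let a, b, c, d be positive integers. If π is an (a−1, b−1)-sharp permutation and τ is a (c−1, d−1)-sharp permutation, then the tensor product π ⊗ τ is (ac−1, bd−1)-sharp. -/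
open Finset in
/-- If related elements carry disjoint colour sets of size at least `c` out of fewer than
`(a + 1) * c` colours, then there is a rank function with values below `a` that is strictly
monotone along the (transitive) relation. -/
theorem exists_rank_of_disjoint {ι κ : Type*} [Fintype ι] [Fintype κ] (R : ι → ι → Prop)
    (htrans : ∀ i j k, R i j → R j k → R i k) (C : ι → Finset κ)
    (hdisj : ∀ i j, R i j → Disjoint (C i) (C j)) {a c : ℕ} (hc : 0 < c)
    (hcard : Fintype.card κ < (a + 1) * c) :
    ∃ f : ι → ℕ, (∀ i, c ≤ #(C i) → f i < a) ∧
      ∀ i j, c ≤ #(C i) → c ≤ #(C j) → R i j → f i < f j := by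
  classical
  let U : ι → Finset κ := fun i => {x | x ∈ C i ∨ ∃ j, R j i ∧ x ∈ C j}
  have hCU : ∀ i, C i ⊆ U i := fun i x hx => by simp [U, hx]
  have hpos : ∀ i, c ≤ #(C i) → 1 ≤ #(U i) / c := fun i hi =>
    (Nat.one_le_div_iff hc).2 (hi.trans (card_le_card (hCU i)))
  refine ⟨fun i => #(U i) / c - 1, fun i hi => ?_, fun i j hi hj hij => ?_⟩
  · have hlt : #(U i) / c < a + 1 :=
      (Nat.div_lt_iff_lt_mul hc).2 ((card_le_univ _).trans_lt hcard)
    have := hpos i hi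
    dsimp only
    omega
  · have hd : Disjoint (U i) (C j) := by
      rw [disjoint_left]
      intro x hx hxj
      simp only [U, mem_filter, mem_univ, true_and] at hx
      obtain hx | ⟨k, hk, hx⟩ := hx
      · exact disjoint_left.1 (hdisj _ _ hij) hx hxj
      · exact disjoint_left.1 (hdisj _ _ (htrans _ _ _ hk hij)) hx hxj
    have hsub : U i ∪ C j ⊆ U j := by
      refine union_subset (fun x hx => ?_) (hCU j)
      simp only [U, mem_filter, mem_univ, true_and] at hx ⊢
      obtain hx | ⟨k, hk, hx⟩ := hx
      · exact Or.inr ⟨i, hij, hx⟩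
      · exact Or.inr ⟨k, htrans _ _ _ hk hij, hx⟩
    have hle : #(U i) + c ≤ #(U j) := by
      have := card_le_card hsub
      rw [card_union_of_disjoint hd] at this
      omega
    have hdiv : #(U i) / c + 1 ≤ #(U j) / c := by
      rw [← Nat.add_div_right _ hc]
      exact Nat.div_le_div_right hle
    have := hpos i hi
    dsimp only
    omega

/-- The increasing sets `I` and the decreasing sets `D` of `π` together cover `A`. -/
structure CoversOn {n : ℕ} {R S : Type*} (π : Equiv.Perm (Fin n)) (A : Set (Fin n))
    (I : R → Set (Fin n)) (D : S → Set (Fin n)) : Prop where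
  inc : ∀ a, IsIncOn π (I a)
  dec : ∀ b, IsDecOn π (D b)
  cover : ∀ i ∈ A, (∃ a, i ∈ I a) ∨ ∃ b, i ∈ D b

theorem Coverable.exists_coversOn {n : ℕ} {π : Equiv.Perm (Fin n)} {r s : ℕ}
    (h : Coverable π r s) :
    ∃ (I : Fin r → Set (Fin n)) (D : Fin s → Set (Fin n)), CoversOn π Set.univ I D := by
  obtain ⟨c, hI, hD⟩ := h
  refine ⟨_, _, hI, hD, fun i _ => ?_⟩
  cases hc : c i with
  | inl a => exact Or.inl ⟨a, hc⟩
  | inr b => exact Or.inr ⟨b, hc⟩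

theorem CoversOn.coverable {n : ℕ} {R S : Type*} [Fintype R] [Fintype S]
    {π : Equiv.Perm (Fin n)} {I : R → Set (Fin n)} {D : S → Set (Fin n)}
    (h : CoversOn π Set.univ I D) {r s : ℕ} (hR : Fintype.card R ≤ r)
    (hS : Fintype.card S ≤ s) : Coverable π r s := by
  obtain ⟨u⟩ := Function.Embedding.nonempty_of_card_le (β := Fin r) (by simpa using hR)
  obtain ⟨v⟩ := Function.Embedding.nonempty_of_card_le (β := Fin s) (by simpa using hS)
  have key : ∀ i, ∃ x : R ⊕ S, (∀ a, x = Sum.inl a → i ∈ I a) ∧ ∀ b, x = Sum.inr b → i ∈ D b := by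
    intro i
    obtain ⟨a, ha⟩ | ⟨b, hb⟩ := h.cover i trivial
    · exact ⟨Sum.inl a, by simp [ha], by simp⟩
    · exact ⟨Sum.inr b, by simp, by simp [hb]⟩
  choose x hxI hxD using key
  refine ⟨fun i => Sum.map u v (x i), fun a i hi j hj hij => ?_, fun b i hi j hj hij => ?_⟩
  · change Sum.map u v (x i) = _ at hi
    change Sum.map u v (x j) = _ at hj
    rcases hp : x i with p | p <;> rw [hp] at hi <;> cases hi
    rcases hq : x j with q | q <;> rw [hq] at hj
    · obtain rfl := u.injective (Sum.inl.inj hj)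
      exact h.inc _ _ (hxI _ _ hp) _ (hxI _ _ hq) hij
    · cases hj
  · change Sum.map u v (x i) = _ at hi
    change Sum.map u v (x j) = _ at hj
    rcases hp : x i with p | p <;> rw [hp] at hi <;> cases hi
    rcases hq : x j with q | q <;> rw [hq] at hj
    · cases hj
    · obtain rfl := v.injective (Sum.inr.inj hj)
      exact h.dec _ _ (hxD _ _ hp) _ (hxD _ _ hq) hij

/-- Removing one entry from a permutation leaves a proper pattern. -/
theorem exists_properPattern_ne {n : ℕ} (π : Equiv.Perm (Fin (n + 1))) (i₀ : Fin (n + 1)) :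
    ∃ σ : Equiv.Perm (Fin n), ∀ i j, σ i < σ j ↔ π (i₀.succAbove i) < π (i₀.succAbove j) := by
  let e : {x // x ≠ i₀} ≃ {x // x ≠ π i₀} := π.subtypeEquiv fun x => by simp
  refine ⟨((finSuccAboveOrderIso i₀).toEquiv.trans e).trans (finSuccAboveOrderIso (π i₀)).symm.toEquiv,
    fun i j => ?_⟩
  simp [e, ← Subtype.coe_lt_coe, finSuccAboveOrderIso_apply]

theorem RSCritical.exists_coversOn_ne {n : ℕ} {π : Equiv.Perm (Fin n)} {r s : ℕ}
    (h : RSCritical π r s) (i₀ : Fin n) :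
    ∃ (I : Fin r → Set (Fin n)) (D : Fin s → Set (Fin n)), CoversOn π {i | i ≠ i₀} I D := by
  obtain _ | n := n
  · exact i₀.elim0
  obtain ⟨σ, hσ⟩ := exists_properPattern_ne π i₀
  obtain ⟨I, D, hID⟩ := (h.2 n σ ⟨n.lt_succ_self, i₀.succAbove, i₀.strictMono_succAbove,
    hσ⟩).exists_coversOn
  refine ⟨fun a => i₀.succAbove '' I a, fun b => i₀.succAbove '' D b, ?_, ?_, ?_⟩
  · rintro a _ ⟨i, hi, rfl⟩ _ ⟨j, hj, rfl⟩ hij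
    exact (hσ _ _).1 (hID.inc a i hi j hj (Fin.succAbove_lt_succAbove_iff.1 hij))
  · rintro b _ ⟨i, hi, rfl⟩ _ ⟨j, hj, rfl⟩ hij
    exact (hσ _ _).1 (hID.dec b i hi j hj (Fin.succAbove_lt_succAbove_iff.1 hij))
  · intro i hi
    obtain ⟨j, rfl⟩ := Fin.exists_succAbove_eq hi
    exact (hID.cover j trivial).imp (fun ⟨a, ha⟩ => ⟨a, j, ha, rfl⟩)
      fun ⟨b, hb⟩ => ⟨b, j, hb, rfl⟩

theorem CoversOn.coverable_of_pattern {n m : ℕ} {R S : Type*} [Fintype R] [Fintype S]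
    {π : Equiv.Perm (Fin n)} {σ : Equiv.Perm (Fin m)} {A : Set (Fin n)}
    {I : R → Set (Fin n)} {D : S → Set (Fin n)} (h : CoversOn π A I D)
    {f : Fin m → Fin n} (hf : StrictMono f) (hσ : ∀ i j, σ i < σ j ↔ π (f i) < π (f j))
    (hA : ∀ i, f i ∈ A) {r s : ℕ} (hR : Fintype.card R ≤ r) (hS : Fintype.card S ≤ s) :
    Coverable σ r s := by
  refine CoversOn.coverable (I := fun a => f ⁻¹' I a) (D := fun b => f ⁻¹' D b)
    ⟨?_, ?_, fun i _ => h.cover _ (hA i)⟩ hR hS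
  · exact fun a i hi j hj hij => (hσ _ _).2 (h.inc a _ hi _ hj (hf hij))
  · exact fun b i hi j hj hij => (hσ _ _).2 (h.dec b _ hi _ hj (hf hij))

theorem finProdFinEquiv_lt_iff {n m : ℕ} (p q : Fin n × Fin m) :
    finProdFinEquiv p < finProdFinEquiv q ↔ p.1 < q.1 ∨ p.1 = q.1 ∧ p.2 < q.2 := by
  obtain ⟨⟨i, hi⟩, ⟨j, hj⟩⟩ := p
  obtain ⟨⟨k, hk⟩, ⟨l, hl⟩⟩ := q
  simp only [Fin.lt_def, finProdFinEquiv_apply_val, Fin.mk.injEq]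
  rcases lt_trichotomy i k with h | rfl | h
  · simp only [h, true_or, iff_true]
    nlinarith
  · simp
  · simp only [h.not_gt, h.ne', false_and, or_self, iff_false, not_lt]
    nlinarith

theorem tensorProd_apply {n m : ℕ} (π : Equiv.Perm (Fin n)) (τ : Equiv.Perm (Fin m))
    (p : Fin n × Fin m) :
    tensorProd π τ (finProdFinEquiv p) = finProdFinEquiv (π p.1, τ p.2) := by
  simp [tensorProd, Prod.map]

theorem isIncOn_tensorProd_iff {n m : ℕ} (π : Equiv.Perm (Fin n)) (τ : Equiv.Perm (Fin m))
    (X : Set (Fin n × Fin m)) :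
    IsIncOn (tensorProd π τ) (finProdFinEquiv '' X) ↔ ∀ p ∈ X, ∀ q ∈ X,
      (p.1 < q.1 → π p.1 < π q.1) ∧ (p.1 = q.1 → p.2 < q.2 → τ p.2 < τ q.2) := by
  simp only [IsIncOn, Set.forall_mem_image, tensorProd_apply, finProdFinEquiv_lt_iff,
    EmbeddingLike.apply_eq_iff_eq]
  refine forall₂_congr fun p _ => forall₂_congr fun q _ => ⟨fun h => ⟨fun hlt => ?_, ?_⟩, ?_⟩
  · exact (h (Or.inl hlt)).resolve_right fun h => hlt.ne h.1
  · exact fun heq hlt => ((h (Or.inr ⟨heq, hlt⟩)).resolve_left (by simp [heq])).2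
  · rintro ⟨h₁, h₂⟩ (hlt | ⟨heq, hlt⟩)
    · exact Or.inl (h₁ hlt)
    · exact Or.inr ⟨heq, h₂ heq hlt⟩

theorem isDecOn_tensorProd_iff {n m : ℕ} (π : Equiv.Perm (Fin n)) (τ : Equiv.Perm (Fin m))
    (X : Set (Fin n × Fin m)) :
    IsDecOn (tensorProd π τ) (finProdFinEquiv '' X) ↔ ∀ p ∈ X, ∀ q ∈ X,
      (p.1 < q.1 → π q.1 < π p.1) ∧ (p.1 = q.1 → p.2 < q.2 → τ q.2 < τ p.2) := by
  simp only [IsDecOn, Set.forall_mem_image, tensorProd_apply, finProdFinEquiv_lt_iff,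
    EmbeddingLike.apply_eq_iff_eq]
  refine forall₂_congr fun p _ => forall₂_congr fun q _ => ⟨fun h => ⟨fun hlt => ?_, ?_⟩, ?_⟩
  · exact (h (Or.inl hlt)).resolve_right fun h => hlt.ne h.1.symm
  · exact fun heq hlt => ((h (Or.inr ⟨heq, hlt⟩)).resolve_left (by simp [heq])).2
  · rintro ⟨h₁, h₂⟩ (hlt | ⟨heq, hlt⟩)
    · exact Or.inl (h₁ hlt)
    · exact Or.inr ⟨heq.symm, h₂ heq hlt⟩

/-- Decreasing covers of the factors multiply to a decreasing cover of the tensor product. -/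
theorem Coverable.tensorProd_zero {n m : ℕ} {π : Equiv.Perm (Fin n)} {τ : Equiv.Perm (Fin m)}
    {b d : ℕ} (hπ : Coverable π 0 b) (hτ : Coverable τ 0 d) :
    Coverable (tensorProd π τ) 0 (b * d) := by
  obtain ⟨_, D, hD⟩ := hπ.exists_coversOn
  obtain ⟨_, H, hH⟩ := hτ.exists_coversOn
  refine CoversOn.coverable (R := Fin 0) (S := Fin b × Fin d) (I := Fin.elim0)
    (D := fun k => finProdFinEquiv '' (D k.1 ×ˢ H k.2)) ⟨fun a => a.elim0, ?_, ?_⟩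
    (by simp) (by simp)
  · rintro ⟨k, t⟩
    rw [isDecOn_tensorProd_iff]
    exact fun p hp q hq =>
      ⟨hD.dec k _ hp.1 _ hq.1, fun _ => hH.dec t _ hp.2 _ hq.2⟩
  · intro x _
    obtain ⟨p, rfl⟩ := finProdFinEquiv.surjective x
    obtain ⟨k, hk⟩ := (hD.cover p.1 trivial).resolve_left fun ⟨a, _⟩ => a.elim0
    obtain ⟨t, ht⟩ := (hH.cover p.2 trivial).resolve_left fun ⟨a, _⟩ => a.elim0
    exact Or.inr ⟨(k, t), p, ⟨hk, ht⟩, rfl⟩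

open Finset in
theorem not_coverable_tensorProd {n m a b c d : ℕ} {π : Equiv.Perm (Fin n)}
    {τ : Equiv.Perm (Fin m)} (hπ : ¬ Coverable π a b) (hτ : ¬ Coverable τ c d) :
    ¬ Coverable (tensorProd π τ) ((a + 1) * (c + 1) - 1) ((b + 1) * (d + 1) - 1) := by
  classical
  intro h
  obtain ⟨I, D, hID⟩ := h.exists_coversOn
  have hI := fun x => (isIncOn_tensorProd_iff π τ (finProdFinEquiv ⁻¹' I x)).1
    (by rw [Set.image_preimage_eq _ finProdFinEquiv.surjective]; exact hID.inc x)
  have hD := fun x => (isDecOn_tensorProd_iff π τ (finProdFinEquiv ⁻¹' D x)).1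
    (by rw [Set.image_preimage_eq _ finProdFinEquiv.surjective]; exact hID.dec x)
  let P : Fin n → Finset (Fin ((a + 1) * (c + 1) - 1)) :=
    fun i => {x | ∃ j, finProdFinEquiv (i, j) ∈ I x}
  let Q : Fin n → Finset (Fin ((b + 1) * (d + 1) - 1)) :=
    fun i => {x | ∃ j, finProdFinEquiv (i, j) ∈ D x}
  -- each copy of `τ` uses many increasing or many decreasing colours
  have hPQ : ∀ i, c + 1 ≤ #(P i) ∨ d + 1 ≤ #(Q i) := by
    intro i
    by_contra! hlt
    refine hτ (CoversOn.coverable (R := P i) (S := Q i)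
      (I := fun x => {j | finProdFinEquiv (i, j) ∈ I x})
      (D := fun x => {j | finProdFinEquiv (i, j) ∈ D x})
      ⟨fun x j hj k hk => ?_, fun x j hj k hk => ?_, fun j _ => ?_⟩ ?_ ?_)
    · exact (hI x (i, j) hj (i, k) hk).2 rfl
    · exact (hD x (i, j) hj (i, k) hk).2 rfl
    · refine (hID.cover (finProdFinEquiv (i, j)) trivial).imp ?_ ?_
      · exact fun ⟨x, hx⟩ => ⟨⟨x, by simpa [P] using ⟨j, hx⟩⟩, hx⟩
      · exact fun ⟨x, hx⟩ => ⟨⟨x, by simpa [Q] using ⟨j, hx⟩⟩, hx⟩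
    · rw [Fintype.card_coe]; omega
    · rw [Fintype.card_coe]; omega
  have hlt : ∀ x y : ℕ, (x + 1) * (y + 1) - 1 < (x + 1) * (y + 1) :=
    fun x y => Nat.sub_lt (by positivity) one_pos
  obtain ⟨f, hf, hfR⟩ := exists_rank_of_disjoint (fun i j => i < j ∧ π j < π i)
    (fun i j k hij hjk => ⟨hij.1.trans hjk.1, hjk.2.trans hij.2⟩) P
    (fun i j hij => disjoint_left.2 fun x hx hy => by
      simp only [P, mem_filter, mem_univ, true_and] at hx hy
      obtain ⟨k, hk⟩ := hx
      obtain ⟨l, hl⟩ := hy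
      exact hij.2.asymm ((hI x (i, k) hk (j, l) hl).1 hij.1))
    c.succ_pos (by rw [Fintype.card_fin]; exact hlt a c)
  obtain ⟨g, hg, hgR⟩ := exists_rank_of_disjoint (fun i j => i < j ∧ π i < π j)
    (fun i j k hij hjk => ⟨hij.1.trans hjk.1, hij.2.trans hjk.2⟩) Q
    (fun i j hij => disjoint_left.2 fun x hx hy => by
      simp only [Q, mem_filter, mem_univ, true_and] at hx hy
      obtain ⟨k, hk⟩ := hx
      obtain ⟨l, hl⟩ := hy
      exact hij.2.asymm ((hD x (i, k) hk (j, l) hl).1 hij.1))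
    d.succ_pos (by rw [Fintype.card_fin]; exact hlt b d)
  refine hπ (CoversOn.coverable (R := Fin a) (S := Fin b)
    (I := fun x => {i | c + 1 ≤ #(P i) ∧ f i = x})
    (D := fun x => {i | d + 1 ≤ #(Q i) ∧ g i = x})
    ⟨fun x i hi j hj hij => ?_, fun x i hi j hj hij => ?_, fun i _ => ?_⟩ (by simp) (by simp))
  · by_contra hle
    have hji : π j < π i := lt_of_le_of_ne (not_lt.1 hle) (π.injective.ne hij.ne')
    exact (hfR i j hi.1 hj.1 ⟨hij, hji⟩).ne (hi.2.trans hj.2.symm)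
  · by_contra hle
    have hji : π i < π j := lt_of_le_of_ne (not_lt.1 hle) (π.injective.ne hij.ne)
    exact (hgR i j hi.1 hj.1 ⟨hij, hji⟩).ne (hi.2.trans hj.2.symm)
  · exact (hPQ i).imp (fun h => ⟨⟨f i, hf i h⟩, h, rfl⟩) fun h => ⟨⟨g i, hg i h⟩, h, rfl⟩

/-- A cover of `π ⊗ τ` without the entry `(i₀, j₀)`. Let `D` be the decreasing cover of `π` and
`I`, `E` the cover of `π` without `i₀`; let `H` be the decreasing cover of `τ` and `J`, `G` the
cover of `τ` without `j₀`. A copy of `τ` in `D k` always has the `d` decreasing colours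
`(k, t)` at its disposal. If it lies in `E l`, it gets the further colour `l` and is covered by `H`;
otherwise it is covered by `J`, `G` and, unless it is the copy `i₀`, the singleton of `j₀`. -/
theorem exists_coversOn_tensorProd_ne {n m a b c d : ℕ} {π : Equiv.Perm (Fin n)}
    {τ : Equiv.Perm (Fin m)} (hπ : RSSharp π a b) (hτ : RSSharp τ c d)
    (i₀ : Fin n) (j₀ : Fin m) :
    ∃ (I : (Fin a × Option (Fin c)) ⊕ Fin c → Set (Fin (n * m)))
      (D : (Fin (b + 1) × Fin d) ⊕ Fin b → Set (Fin (n * m))),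
      CoversOn (tensorProd π τ) {x | x ≠ finProdFinEquiv (i₀, j₀)} I D := by
  obtain ⟨_, D, hD⟩ := hπ.2.exists_coversOn
  obtain ⟨_, H, hH⟩ := hτ.2.exists_coversOn
  obtain ⟨I, E, hIE⟩ := hπ.1.exists_coversOn_ne i₀
  obtain ⟨J, G, hJG⟩ := hτ.1.exists_coversOn_ne j₀
  refine ⟨fun x => finProdFinEquiv '' x.elim
      (fun y => I y.1 ×ˢ y.2.elim {j₀} J) (fun t => {i₀} ×ˢ J t),
    fun x => finProdFinEquiv '' x.elim
      (fun y => {p | p.1 ∈ D y.1 ∧ (((∃ l, p.1 ∈ E l) ∧ p.2 ∈ H y.2.castSucc) ∨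
        ((¬ ∃ l, p.1 ∈ E l) ∧ p.2 ∈ G y.2))})
      (fun l => E l ×ˢ H (Fin.last d)), ?_, ?_, ?_⟩
  · intro x
    rw [isIncOn_tensorProd_iff]
    rcases x with ⟨l, _ | t⟩ | t
    · rintro ⟨i, j⟩ ⟨hi, rfl : j = j₀⟩ ⟨i', j'⟩ ⟨hi', rfl : j' = j⟩
      exact ⟨hIE.inc l _ hi _ hi', fun _ h => (lt_irrefl _ h).elim⟩
    · exact fun p hp q hq => ⟨hIE.inc l _ hp.1 _ hq.1, fun _ => hJG.inc t _ hp.2 _ hq.2⟩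
    · rintro ⟨i, j⟩ ⟨rfl : i = i₀, hj⟩ ⟨i', j'⟩ ⟨rfl : i' = i, hj'⟩
      exact ⟨fun h => (lt_irrefl _ h).elim, fun _ => hJG.inc t _ hj _ hj'⟩
  · intro x
    rw [isDecOn_tensorProd_iff]
    rcases x with ⟨k, t⟩ | l
    · rintro ⟨i, j⟩ ⟨hi, hij⟩ ⟨i', j'⟩ ⟨hi', hij'⟩
      refine ⟨hD.dec k _ hi _ hi', ?_⟩
      rintro rfl
      obtain ⟨hE, hj⟩ | ⟨hE, hj⟩ := hij
      · exact hH.dec _ _ hj _ (hij'.resolve_right fun h => h.1 hE).2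
      · exact hJG.dec _ _ hj _ (hij'.resolve_left fun h => hE h.1).2
    · exact fun p hp q hq => ⟨hIE.dec l _ hp.1 _ hq.1, fun _ => hH.dec _ _ hp.2 _ hq.2⟩
  · intro x hx
    obtain ⟨⟨i, j⟩, rfl⟩ := finProdFinEquiv.surjective x
    simp only [finProdFinEquiv.injective.mem_set_image]
    obtain ⟨k, hk⟩ := (hD.cover i trivial).resolve_left fun ⟨a, _⟩ => a.elim0
    by_cases hE : ∃ l, i ∈ E l
    · obtain ⟨t, ht⟩ := (hH.cover j trivial).resolve_left fun ⟨a, _⟩ => a.elim0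
      refine Or.inr ?_
      cases t using Fin.lastCases with
      | last => exact hE.imp' Sum.inr fun l hl => ⟨hl, ht⟩
      | cast t => exact ⟨Sum.inl (k, t), hk, Or.inl ⟨hE, ht⟩⟩
    · have hI : i ≠ i₀ → ∃ l, i ∈ I l := fun hi => (hIE.cover i hi).resolve_right hE
      by_cases hj : j = j₀
      · subst hj
        obtain ⟨l, hl⟩ := hI fun h => hx (by rw [h])
        exact Or.inl ⟨Sum.inl (l, none), hl, rfl⟩
      · obtain ⟨t, ht⟩ | ⟨t, ht⟩ := hJG.cover j hj
        · by_cases hi : i = i₀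
          · exact Or.inl ⟨Sum.inr t, hi, ht⟩
          · obtain ⟨l, hl⟩ := hI hi
            exact Or.inl ⟨Sum.inl (l, some t), hl, ht⟩
        · exact Or.inr ⟨Sum.inl (k, t), hk, Or.inr ⟨hE, ht⟩⟩

/-- Lemma 8: the tensor product of an `(a−1,b−1)`-sharp permutation and a
`(c−1,d−1)`-sharp permutation is `(ac−1,bd−1)`-sharp. -/
theorem sharp_tensor {n m : ℕ} (a b c d : ℕ)
    (ha : 1 ≤ a) (hb : 1 ≤ b) (hc : 1 ≤ c) (hd : 1 ≤ d)
    (π : Equiv.Perm (Fin n)) (τ : Equiv.Perm (Fin m))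
    (hπ : RSSharp π (a - 1) (b - 1)) (hτ : RSSharp τ (c - 1) (d - 1)) :
    RSSharp (tensorProd π τ) (a * c - 1) (b * d - 1) := by
  obtain ⟨a, rfl⟩ := Nat.exists_eq_add_of_le' ha
  obtain ⟨b, rfl⟩ := Nat.exists_eq_add_of_le' hb
  obtain ⟨c, rfl⟩ := Nat.exists_eq_add_of_le' hc
  obtain ⟨d, rfl⟩ := Nat.exists_eq_add_of_le' hd
  simp only [Nat.add_sub_cancel] at hπ hτ
  refine ⟨⟨not_coverable_tensorProd hπ.1.1 hτ.1.1, ?_⟩, ?_⟩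
  · rintro k σ ⟨hk, f, hf, hσ⟩
    have hsurj : ¬ Function.Surjective f := fun h =>
      hk.not_ge (by simpa using Fintype.card_le_of_surjective f h)
    obtain ⟨x, hx⟩ := not_forall.1 hsurj
    obtain ⟨⟨i₀, j₀⟩, rfl⟩ := finProdFinEquiv.surjective x
    obtain ⟨I, D, hID⟩ := exists_coversOn_tensorProd_ne hπ hτ i₀ j₀
    refine hID.coverable_of_pattern hf hσ (fun i h => hx ⟨i, h⟩) ?_ ?_
    · simp only [Fintype.card_sum, Fintype.card_prod, Fintype.card_option, Fintype.card_fin]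
      exact Nat.le_sub_one_of_lt (by linarith)
    · simp only [Fintype.card_sum, Fintype.card_prod, Fintype.card_fin]
      exact Nat.le_sub_one_of_lt (by linarith)
  · rw [Nat.sub_add_cancel (Nat.mul_pos hb hd)]
    exact hπ.2.tensorProd_zero hτ.2
end

section
/- Let r, s, k ∈ ℕ. (i) If τ is an (r,s)-critical permutation, then there exists an (r+s)-critical permutation containing τ as a pattern. (ii) If τ is a k-critical permutation, then there exists a (k+1)-critical permutation containing τ as a proper pattern (in particular, of length strictly greater than that of τ). -/
theorem Sum.eq_inl_of_map_id_eq_inl {α β γ : Type*} {h : β → γ} {x : α ⊕ β} {a : α}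
    (hx : Sum.map id h x = Sum.inl a) : x = Sum.inl a := by
  cases x <;> simp_all

theorem Sum.exists_eq_inr_of_map_eq_inr {α β γ δ : Type*} {f : α → γ} {h : β → δ} {x : α ⊕ β}
    {d : δ} (hx : Sum.map f h x = Sum.inr d) : ∃ b, x = Sum.inr b ∧ h b = d := by
  cases x <;> simp_all

/-- The points `(f i, g i)` can be partitioned into `r` increasing and `s` decreasing sequences. -/
def PointsCoverable {ι A B : Type*} [LinearOrder A] [LinearOrder B] (f : ι → A) (g : ι → B)
    (r s : ℕ) : Prop :=
  ∃ c : ι → Fin r ⊕ Fin s,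
    (∀ a i j, c i = Sum.inl a → c j = Sum.inl a → f i < f j → g i < g j) ∧
    (∀ b i j, c i = Sum.inr b → c j = Sum.inr b → f i < f j → g j < g i)

section Points

variable {ι κ A B : Type*} [LinearOrder A] [LinearOrder B]

theorem coverable_iff_pointsCoverable {n : ℕ} {π : Equiv.Perm (Fin n)} {r s : ℕ} :
    Coverable π r s ↔ PointsCoverable id π r s := by
  constructor
  · rintro ⟨c, h1, h2⟩
    exact ⟨c, fun a i j hi hj => h1 a i hi j hj, fun b i j hi hj => h2 b i hi j hj⟩
  · rintro ⟨c, h1, h2⟩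
    exact ⟨c, fun a i hi j hj => h1 a i j hi hj, fun b i hi j hj => h2 b i j hi hj⟩

/-- Coverability passes to an order-preserving family of points. -/
theorem PointsCoverable.of_map {A' B' : Type*} [LinearOrder A'] [LinearOrder B']
    {f : ι → A} {g : ι → B} {f' : κ → A'} {g' : κ → B'} {r s : ℕ}
    (h : PointsCoverable f g r s) (F : κ → ι)
    (hf : ∀ i j, f' i < f' j → f (F i) < f (F j))
    (hg : ∀ i j, g (F i) < g (F j) → g' i < g' j) :
    PointsCoverable f' g' r s := by
  obtain ⟨c, h1, h2⟩ := h
  exact ⟨c ∘ F, fun a i j hi hj hij => hg _ _ (h1 a _ _ hi hj (hf _ _ hij)),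
    fun b i j hi hj hij => hg _ _ (h2 b _ _ hi hj (hf _ _ hij))⟩

/-- Finitely many points with distinct coordinates realize a permutation. -/
theorem exists_perm_of_points [Fintype ι] {f : ι → A} {g : ι → B}
    (hf : Function.Injective f) (hg : Function.Injective g) :
    ∃ (π : Equiv.Perm (Fin (Fintype.card ι))) (e : Fin (Fintype.card ι) ≃ ι),
      (∀ i j, f (e i) < f (e j) ↔ i < j) ∧ ∀ i j, π i < π j ↔ g (e i) < g (e j) := by
  let e₁ := @monoEquivOfFin ι _ (LinearOrder.lift' f hf) _ rfl
  let e₂ := @monoEquivOfFin ι _ (LinearOrder.lift' g hg) _ rfl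
  refine ⟨e₁.toEquiv.trans e₂.toEquiv.symm, e₁.toEquiv, fun i j => ?_, fun i j => ?_⟩
  · exact @OrderIso.lt_iff_lt _ _ _ (LinearOrder.lift' f hf).toPreorder e₁ i j
  · exact @OrderIso.lt_iff_lt _ _ (LinearOrder.lift' g hg).toPreorder _
      (@OrderIso.symm _ _ _ (LinearOrder.lift' g hg).toLE e₂) (e₁.toEquiv i) (e₁.toEquiv j)

/-- The points of `τ` other than `e` form a proper pattern of `τ`. -/
theorem exists_properPattern_delete {m : ℕ} (τ : Equiv.Perm (Fin m)) (e : Fin m) :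
    ∃ (n : ℕ) (σ : Equiv.Perm (Fin n)), ProperPattern σ τ ∧ ∀ r s, Coverable σ r s →
      PointsCoverable (fun x : {x // x ≠ e} => x.1) (fun x => τ x.1) r s := by
  obtain ⟨σ, E, h1, h2⟩ := exists_perm_of_points (ι := {x // x ≠ e}) (f := fun x => x.1)
    (g := fun x => τ x.1) Subtype.val_injective (τ.injective.comp Subtype.val_injective)
  refine ⟨_, σ, ⟨?_, fun i => (E i).1, fun i j h => (h1 i j).2 h, h2⟩, fun r s h => ?_⟩
  · simpa using Fintype.card_subtype_lt (p := fun x => x ≠ e) (x := e) (by simp)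
  · refine (coverable_iff_pointsCoverable.1 h).of_map E.symm (fun i j hij => ?_) (fun i j hij => ?_)
    · exact (h1 _ _).1 (by simpa using hij)
    · simpa using (h2 _ _).1 hij

theorem RSCritical.pointsCoverable_delete {m r s : ℕ} {τ : Equiv.Perm (Fin m)}
    (h : RSCritical τ r s) (e : Fin m) :
    PointsCoverable (fun x : {x // x ≠ e} => x.1) (fun x => τ x.1) r s := by
  obtain ⟨n, σ, hσ, H⟩ := exists_properPattern_delete τ e
  exact H _ _ (h.2 n σ hσ)

theorem KCritical.exists_pointsCoverable_delete {m k : ℕ} {τ : Equiv.Perm (Fin m)}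
    (h : KCritical τ k) (e : Fin m) :
    ∃ r s, r + s = k ∧
      PointsCoverable (fun x : {x // x ≠ e} => x.1) (fun x => τ x.1) r s := by
  obtain ⟨n, σ, hσ, H⟩ := exists_properPattern_delete τ e
  obtain ⟨r, s, hrs, hc⟩ := h.2 n σ hσ
  exact ⟨r, s, hrs, H _ _ hc⟩

/-- If a configuration of points is not `k`-coverable, but becomes so after the removal of any
point of a copy of `τ`, then `τ` is a pattern of a `k`-critical permutation. -/
theorem exists_kCritical_of_points [Fintype ι] {f : ι → A} {g : ι → B}
    (hf : Function.Injective f) (hg : Function.Injective g) {m k : ℕ} (τ : Equiv.Perm (Fin m))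
    (φ : Fin m → ι) (hφf : ∀ i j, i < j → f (φ i) < f (φ j))
    (hφg : ∀ i j, τ i < τ j ↔ g (φ i) < g (φ j))
    (hnot : ∀ r s, r + s = k → ¬ PointsCoverable f g r s)
    (hdel : ∀ e, ∃ r s, r + s = k ∧
      PointsCoverable (fun x : {x // x ≠ φ e} => f x.1) (fun x => g x.1) r s) :
    ∃ (n : ℕ) (π : Equiv.Perm (Fin n)), KCritical π k ∧ Pattern τ π := by
  classical
  let P : ℕ → Prop := fun n => ∃ (π : Equiv.Perm (Fin n)) (F : Fin n → ι),
    (∀ i j, f (F i) < f (F j) ↔ i < j) ∧ (∀ i j, π i < π j ↔ g (F i) < g (F j)) ∧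
    ¬ KCoverable π k
  have hP : ∃ n, P n := by
    obtain ⟨π, E, h1, h2⟩ := exists_perm_of_points hf hg
    refine ⟨_, π, E, h1, h2, ?_⟩
    rintro ⟨r, s, hrs, hc⟩
    refine hnot r s hrs ((coverable_iff_pointsCoverable.1 hc).of_map E.symm
      (fun i j hij => ?_) (fun i j hij => ?_))
    · exact (h1 _ _).1 (by simpa using hij)
    · simpa using (h2 _ _).1 hij
  obtain ⟨π, F, h1, h2, h3⟩ := Nat.find_spec hP
  refine ⟨Nat.find hP, π, ⟨h3, ?_⟩, ?_⟩
  · rintro n σ ⟨hn, G, hG, hGσ⟩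
    by_contra hσ
    refine Nat.find_min hP hn ⟨σ, F ∘ G, fun i j => ?_, fun i j => ?_, hσ⟩
    · exact (h1 _ _).trans hG.lt_iff_lt
    · exact (hGσ i j).trans (h2 _ _)
  · have hmem : ∀ e, ∃ x, F x = φ e := by
      intro e
      by_contra! hne
      obtain ⟨r, s, hrs, hc⟩ := hdel e
      exact h3 ⟨r, s, hrs, coverable_iff_pointsCoverable.2 (hc.of_map (fun x => ⟨F x, hne x⟩)
        (fun i j hij => (h1 i j).2 hij) (fun i j hij => (h2 i j).2 hij))⟩
    choose G hG using hmem
    refine ⟨G, fun i j hij => ?_, fun i j => ?_⟩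
    · rw [← h1, hG, hG]
      exact hφf i j hij
    · rw [h2, hG, hG]
      exact hφg i j

end Points

/-- Pigeonhole on a grid: colours in `α` occur in one row only, and colours in `β` occur at most
once in each row. -/
theorem card_le_of_grid_colouring {α β : Type*} [Fintype α] [Fintype β] {p L : ℕ}
    (c : Fin p × Fin L → α ⊕ β) (hL : Fintype.card β < L)
    (hα : ∀ x y u, c x = Sum.inl u → c y = Sum.inl u → x.1 = y.1)
    (hβ : ∀ a j j' v, c (a, j) = Sum.inr v → c (a, j') = Sum.inr v → j = j') :
    p ≤ Fintype.card α := by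
  have hrow : ∀ a, ∃ j u, c (a, j) = Sum.inl u := by
    intro a
    by_contra! hne
    have hv : ∀ j, ∃ v, c (a, j) = Sum.inr v := by
      intro j
      rcases hc : c (a, j) with u | v
      · exact absurd hc (hne j u)
      · exact ⟨v, rfl⟩
    choose v hv using hv
    have hinj : Function.Injective v := fun j j' h => hβ a j j' (v j) (hv j) (h ▸ hv j')
    have := Fintype.card_le_of_injective v hinj
    simp at this
    omega
  choose j u hu using hrow
  have hinj : Function.Injective u := fun a a' h => hα _ _ (u a) (hu a) (h ▸ hu a')
  simpa using Fintype.card_le_of_injective u hinj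

/-- Every `(r,s)`-critical permutation is a pattern of an `(r+s)`-critical one: place above and to
the right of it a skew sum of `r` long increasing sequences, and then below and to the right of
everything a direct sum of `s` long decreasing sequences. -/
theorem RSCritical.exists_kCritical {r s m : ℕ} {τ : Equiv.Perm (Fin m)} (hτ : RSCritical τ r s) :
    ∃ (n : ℕ) (π : Equiv.Perm (Fin n)), KCritical π (r + s) ∧ Pattern τ π := by
  let L := r + s + 1
  let f : Fin m ⊕ (Fin r × Fin L) ⊕ (Fin s × Fin L) → ℕ ×ₗ ℕ ×ₗ ℕ := fun x => match x with
    | .inl i => toLex (0, toLex (i.val, 0))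
    | .inr (.inl y) => toLex (1, toLex (y.1.val, y.2.val))
    | .inr (.inr z) => toLex (2, toLex (z.1.val, z.2.val))
  let g : Fin m ⊕ (Fin r × Fin L) ⊕ (Fin s × Fin L) → ℕ ×ₗ ℕ ×ₗ ℕ := fun x => match x with
    | .inl i => toLex (1, toLex ((τ i).val, 0))
    | .inr (.inl y) => toLex (2, toLex (y.1.rev.val, y.2.val))
    | .inr (.inr z) => toLex (0, toLex (z.1.val, z.2.rev.val))
  have hf : Function.Injective f := by
    rintro (i | ⟨a, j⟩ | ⟨b, j⟩) (i' | ⟨a', j'⟩ | ⟨b', j'⟩) h <;>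
      simp [f, Fin.val_inj] at h ⊢ <;> exact h
  have hg : Function.Injective g := by
    rintro (i | ⟨a, j⟩ | ⟨b, j⟩) (i' | ⟨a', j'⟩ | ⟨b', j'⟩) h <;>
      simp [g, -Fin.val_rev, Fin.val_inj] at h ⊢ <;> exact h
  refine exists_kCritical_of_points hf hg τ Sum.inl ?_ ?_ ?_ ?_
  · intro i j hij
    simpa [f, Prod.Lex.toLex_lt_toLex] using hij
  · intro i j
    simp [g, Prod.Lex.toLex_lt_toLex]
  · rintro r' s' hrs ⟨c, h1, h2⟩
    have hr : r ≤ r' := by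
      have := card_le_of_grid_colouring (fun y => c (.inr (.inl y))) (by simp [L]; omega)
        (fun x y u hx hy => by
          have h3 := h1 u _ _ hx hy
          have h4 := h1 u _ _ hy hx
          simp [f, g, Prod.Lex.toLex_lt_toLex] at h3 h4
          omega)
        (fun a j j' v hx hy => by
          have h3 := h2 v _ _ hx hy
          have h4 := h2 v _ _ hy hx
          simp [f, g, Prod.Lex.toLex_lt_toLex] at h3 h4
          omega)
      simpa using this
    have hs : s ≤ s' := by
      have hinl : ∀ {z v}, (c (.inr (.inr z))).swap = Sum.inl v → c (.inr (.inr z)) = .inr v :=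
        fun h => by simpa using congrArg Sum.swap h
      have hinr : ∀ {z v}, (c (.inr (.inr z))).swap = Sum.inr v → c (.inr (.inr z)) = .inl v :=
        fun h => by simpa using congrArg Sum.swap h
      have := card_le_of_grid_colouring (fun z => (c (.inr (.inr z))).swap) (by simp [L]; omega)
        (fun x y u hx hy => by
          have h3 := h2 u _ _ (hinl hx) (hinl hy)
          have h4 := h2 u _ _ (hinl hy) (hinl hx)
          simp [f, g, Prod.Lex.toLex_lt_toLex] at h3 h4
          omega)
        (fun a j j' v hx hy => by
          have h3 := h1 v _ _ (hinr hx) (hinr hy)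
          have h4 := h1 v _ _ (hinr hy) (hinr hx)
          simp [f, g, Prod.Lex.toLex_lt_toLex] at h3 h4
          omega)
      simpa using this
    obtain rfl : r' = r := by omega
    obtain rfl : s' = s := by omega
    refine hτ.1 (coverable_iff_pointsCoverable.2
      (PointsCoverable.of_map (f := f) (g := g) ⟨c, h1, h2⟩ Sum.inl ?_ ?_))
    · intro i j hij
      simpa [f, Prod.Lex.toLex_lt_toLex] using hij
    · intro i j hij
      simpa [g, Prod.Lex.toLex_lt_toLex] using hij
  · intro e
    refine ⟨r, s, rfl, ?_⟩
    obtain ⟨c, h1, h2⟩ := hτ.pointsCoverable_delete e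
    refine ⟨fun x => match x with
      | ⟨.inl i, hi⟩ => c ⟨i, fun h => hi (h ▸ rfl)⟩
      | ⟨.inr (.inl y), _⟩ => .inl y.1
      | ⟨.inr (.inr z), _⟩ => .inr z.1, ?_, ?_⟩
    · rintro a ⟨i | ⟨a, j⟩ | ⟨b, j⟩, hi⟩ ⟨i' | ⟨a', j'⟩ | ⟨b', j'⟩, hi'⟩ hx hy hxy
      · simpa [g, Prod.Lex.toLex_lt_toLex] using h1 a _ _ hx hy
          (by simpa [f, Prod.Lex.toLex_lt_toLex] using hxy)
      all_goals
        simp [f, g, Prod.Lex.toLex_lt_toLex] at hx hy hxy ⊢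
      subst hx hy
      simpa using hxy
    · rintro b ⟨i | ⟨a, j⟩ | ⟨b, j⟩, hi⟩ ⟨i' | ⟨a', j'⟩ | ⟨b', j'⟩, hi'⟩ hx hy hxy
      · simpa [g, Prod.Lex.toLex_lt_toLex] using h2 b _ _ hx hy
          (by simpa [f, Prod.Lex.toLex_lt_toLex] using hxy)
      all_goals
        simp [f, g, Prod.Lex.toLex_lt_toLex] at hx hy hxy ⊢
      subst hx hy
      simp at hxy ⊢
      omega

/-- Every `k`-critical permutation is a pattern of a `(k+1)`-critical one: place above and to the
right of it a decreasing sequence of length `k + 2`. -/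
theorem KCritical.exists_kCritical_succ {k m : ℕ} {τ : Equiv.Perm (Fin m)} (hτ : KCritical τ k) :
    ∃ (n : ℕ) (π : Equiv.Perm (Fin n)), KCritical π (k + 1) ∧ Pattern τ π := by
  let f : Fin m ⊕ Fin (k + 2) → ℕ := Sum.elim (fun i => i.val) (fun j => m + j.val)
  let g : Fin m ⊕ Fin (k + 2) → ℕ := Sum.elim (fun i => (τ i).val) (fun j => m + j.rev.val)
  have hf : Function.Injective f := by
    rintro (i | j) (i' | j') h <;> simp [f, Fin.ext_iff] at h ⊢ <;> omega
  have hg : Function.Injective g := by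
    rintro (i | j) (i' | j') h
    · simpa [g, Fin.val_inj] using h
    all_goals simp [g] at h ⊢; omega
  refine exists_kCritical_of_points hf hg τ Sum.inl ?_ ?_ ?_ ?_
  · intro i j hij
    simpa [f] using hij
  · intro i j
    simp [g]
  · rintro r s hrs ⟨c, h1, h2⟩
    obtain ⟨j, b, hb⟩ : ∃ j b, c (.inr j) = .inr b := by
      by_contra! hne
      have hu : ∀ j, ∃ u, c (.inr j) = .inl u := by
        intro j
        rcases hc : c (.inr j) with u | v
        · exact ⟨u, rfl⟩
        · exact absurd hc (hne j v)
      choose u hu using hu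
      have hinj : Function.Injective u := by
        intro j j' h
        have h3 := h1 (u j) _ _ (hu j) (h ▸ hu j')
        have h4 := h1 (u j) _ _ (h ▸ hu j') (hu j)
        simp [f, g] at h3 h4
        omega
      have := Fintype.card_le_of_injective u hinj
      simp at this
      omega
    obtain _ | s := s
    · exact b.elim0
    have hne : ∀ i, c (.inl i) ≠ .inr b := by
      intro i hi
      have h3 := h2 b _ _ hi hb
      simp [f, g] at h3
      omega
    have hd : ∀ i, ∃ d : Fin r ⊕ Fin s, c (.inl i) = Sum.map id b.succAbove d := by
      intro i
      rcases hc : c (.inl i) with u | v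
      · exact ⟨.inl u, rfl⟩
      · obtain ⟨w, hw⟩ := Fin.exists_succAbove_eq (x := v) (y := b)
          (fun h => hne i (h ▸ hc))
        exact ⟨.inr w, by simp [hw]⟩
    choose d hd using hd
    refine hτ.1 ⟨r, s, by omega, coverable_iff_pointsCoverable.2 ⟨d, ?_, ?_⟩⟩
    · intro a i j hi hj hij
      simpa [g] using h1 a (.inl i) (.inl j) (by simp [hd, hi]) (by simp [hd, hj])
        (by simpa [f] using hij)
    · intro v i j hi hj hij
      simpa [g] using h2 (b.succAbove v) (.inl i) (.inl j) (by simp [hd, hi]) (by simp [hd, hj])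
        (by simpa [f] using hij)
  · intro e
    obtain ⟨r, s, hrs, c, h1, h2⟩ := hτ.exists_pointsCoverable_delete e
    refine ⟨r, s + 1, by omega, fun x => match x with
      | ⟨.inl i, hi⟩ => Sum.map id Fin.castSucc (c ⟨i, fun h => hi (h ▸ rfl)⟩)
      | ⟨.inr _, _⟩ => .inr (Fin.last s), ?_, ?_⟩
    · rintro a ⟨i | j, hi⟩ ⟨i' | j', hi'⟩ hx hy hxy
      · have hx := Sum.eq_inl_of_map_id_eq_inl hx
        have hy := Sum.eq_inl_of_map_id_eq_inl hy
        simpa [g] using h1 _ _ _ hx hy (by simpa [f] using hxy)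
      all_goals simp at hx hy
    · rintro b ⟨i | j, hi⟩ ⟨i' | j', hi'⟩ hx hy hxy
      · obtain ⟨v, hv, rfl⟩ := Sum.exists_eq_inr_of_map_eq_inr hx
        obtain ⟨w, hw, hwv⟩ := Sum.exists_eq_inr_of_map_eq_inr hy
        obtain rfl := Fin.castSucc_injective _ hwv
        simpa [g] using h2 _ _ _ hv hw (by simpa [f] using hxy)
      · obtain ⟨v, -, rfl⟩ := Sum.exists_eq_inr_of_map_eq_inr hx
        exact absurd (Sum.inr_injective hy).symm (Fin.castSucc_lt_last v).ne
      · obtain ⟨v, -, rfl⟩ := Sum.exists_eq_inr_of_map_eq_inr hy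
        exact absurd (Sum.inr_injective hx).symm (Fin.castSucc_lt_last v).ne
      · simp [f, g] at hxy ⊢
        omega

/-- A `k`-critical permutation is `(k+1)`-coverable. -/
theorem KCritical.kCoverable_succ {k m : ℕ} {τ : Equiv.Perm (Fin m)} (hτ : KCritical τ k) :
    KCoverable τ (k + 1) := by
  obtain _ | m := m
  · exact ⟨k + 1, 0, rfl, fun i => i.elim0, fun _ i => i.elim0, fun _ i => i.elim0⟩
  obtain ⟨r, s, hrs, c, h1, h2⟩ := hτ.exists_pointsCoverable_delete 0
  refine ⟨r, s + 1, by omega, coverable_iff_pointsCoverable.2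
    ⟨fun i => if h : i ≠ 0 then Sum.map id Fin.castSucc (c ⟨i, h⟩) else .inr (Fin.last s),
      ?_, ?_⟩⟩
  · intro a i j hi hj hij
    dsimp only at hi hj
    split_ifs at hi hj
    exact h1 _ _ _ (Sum.eq_inl_of_map_id_eq_inl hi) (Sum.eq_inl_of_map_id_eq_inl hj) hij
  · intro b i j hi hj hij
    have hj0 : j ≠ 0 := (lt_of_le_of_lt (Fin.zero_le i) hij).ne'
    dsimp only at hi hj
    rw [dif_pos hj0] at hj
    obtain ⟨w, hw, rfl⟩ := Sum.exists_eq_inr_of_map_eq_inr hj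
    split_ifs at hi with hi0
    · obtain ⟨v, hv, hvw⟩ := Sum.exists_eq_inr_of_map_eq_inr hi
      obtain rfl := Fin.castSucc_injective _ hvw
      exact h2 _ _ _ hv hw hij
    · exact absurd (Sum.inr_injective hi).symm (Fin.castSucc_lt_last w).ne

/-- Coverability passes from a pattern to a permutation of the same length. -/
theorem Pattern.coverable_of_length_eq {m r s : ℕ} {τ π : Equiv.Perm (Fin m)} (h : Pattern τ π)
    (hτ : Coverable τ r s) : Coverable π r s := by
  obtain ⟨F, hF, hFτ⟩ := h
  let E := Equiv.ofBijective F (Finite.injective_iff_bijective.1 hF.injective)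
  have hE : ∀ i, F (E.symm i) = i := E.apply_symm_apply
  refine coverable_iff_pointsCoverable.2
    ((coverable_iff_pointsCoverable.1 hτ).of_map E.symm (fun i j hij => ?_) (fun i j hij => ?_))
  · exact hF.lt_iff_lt.1 (by simpa [hE] using hij)
  · simpa [hE] using (hFτ _ _).1 hij

/-- Lemma 9: (i) every `(r,s)`-critical permutation is a pattern of some
`(r+s)`-critical permutation; (ii) every `k`-critical permutation is a proper pattern of
some `(k+1)`-critical permutation. -/
theorem critical_extension :
    (∀ (r s m : ℕ) (τ : Equiv.Perm (Fin m)), RSCritical τ r s →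
      ∃ (n : ℕ) (π : Equiv.Perm (Fin n)), KCritical π (r + s) ∧ Pattern τ π) ∧
    (∀ (k m : ℕ) (τ : Equiv.Perm (Fin m)), KCritical τ k →
      ∃ (n : ℕ) (π : Equiv.Perm (Fin n)), KCritical π (k + 1) ∧ ProperPattern τ π) := by
  refine ⟨fun r s m τ hτ => hτ.exists_kCritical, fun k m τ hτ => ?_⟩
  obtain ⟨n, π, hπ, hpat⟩ := hτ.exists_kCritical_succ
  refine ⟨n, π, hπ, lt_of_le_of_ne ?_ ?_, hpat⟩
  · obtain ⟨F, hF, -⟩ := hpat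
    simpa using Fintype.card_le_of_injective F hF.injective
  · rintro rfl
    obtain ⟨r, s, hrs, hc⟩ := hτ.kCoverable_succ
    exact hπ.1 ⟨r, s, hrs, hpat.coverable_of_length_eq hc⟩
end
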